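/- An aperiodic binary sequence s is Sturmian if and only if its set of factors is closed under reversal and s admits exactly one left special factor of each length k ≥ 1. -/

import Mathlib

/-- The finite word `s(i) s(i+1) ⋯ s(i+k−1)`. -/
def window {A : Type*} (s : ℕ → A) (i k : ℕ) : List A :=
  (List.range k).map fun j => s (i + j)

/-- `l` is a factor of the sequence `s`. -/
def IsFactor {A : Type*} (s : ℕ → A) (l : List A) : Prop :=
  ∃ i, l = window s i l.length

/-- The number of distinct factors of `s` of length `k` (complexity function). -/
noncomputable def complexity {A : Type*} (s : ℕ → A) (k : ℕ) : ℕ :=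
  Set.ncard {l : List A | l.length = k ∧ IsFactor s l}

/-- The shift map. -/
def shiftMap {A : Type*} (s : ℕ → A) : ℕ → A := fun n => s (n + 1)

/-- The sequence `x·u`. -/
def pre {A : Type*} (x : A) (u : ℕ → A) : ℕ → A
  | 0 => x
  | n + 1 => u n

/-- Strict lexicographic order on sequences. -/
def SeqLt {A : Type*} [LT A] (u v : ℕ → A) : Prop :=
  ∃ i, (∀ j < i, u j = v j) ∧ u i < v i

/-- Lexicographic order on sequences. -/
def SeqLe {A : Type*} [LT A] (u v : ℕ → A) : Prop :=
  (∀ n, u n = v n) ∨ SeqLt u v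

/-- Lexicographic order on (equal-length) finite words. -/
def WordLe {A : Type*} [LT A] (u v : List A) : Prop :=
  u = v ∨ List.Lex (· < ·) u v

def UltimatelyPeriodic {A : Type*} (s : ℕ → A) : Prop :=
  ∃ N, ∃ q ≥ 1, ∀ n ≥ N, s (n + q) = s n

/-- A binary sequence is Sturmian if it has complexity `k + 1` for all `k ≥ 1`. -/
def Sturmian (s : ℕ → Fin 2) : Prop :=
  ∀ k ≥ 1, complexity s k = k + 1

/-- `w` is a left special factor of `s`. -/
def LeftSpecial {A : Type*} (s : ℕ → A) (w : List A) : Prop :=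
  ∃ x y : A, x ≠ y ∧ IsFactor s (x :: w) ∧ IsFactor s (y :: w)

/-- A binary sequence is balanced. -/
def BalancedSeq (s : ℕ → Fin 2) : Prop :=
  ∀ u v : List (Fin 2), IsFactor s u → IsFactor s v → u.length = v.length →
    ((u.count 1 : ℤ) - (v.count 1 : ℤ)).natAbs ≤ 1

/-- `u` is the characteristic Sturmian sequence of slope `α`. -/
def IsCharSturmian (α : ℝ) (u : ℕ → Fin 2) : Prop :=
  ∀ n : ℕ, ((u n : ℕ) : ℤ) = ⌊((n : ℝ) + 2) * α⌋ - ⌊((n : ℝ) + 1) * α⌋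


theorem window_len {A : Type*} (s : ℕ → A) (i k : ℕ) : (window s i k).length = k := by
  simp [window]

theorem window_succ_right {A : Type*} (s : ℕ → A) (i k : ℕ) :
    window s i (k+1) = window s i k ++ [s (i+k)] := by
  simp [window, List.range_succ]

theorem window_succ_left {A : Type*} (s : ℕ → A) (i k : ℕ) :
    window s i (k+1) = s i :: window s (i+1) k := by
  simp only [window, List.range_succ_eq_map, List.map_cons, List.map_map, Nat.add_zero]
  congr 1
  apply List.map_congr_left
  intro a _
  simp only [Function.comp]
  congr 1
  omega

theorem window_eq_iff {A : Type*} (s t : ℕ → A) (i j k : ℕ) :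
    window s i k = window t j k ↔ ∀ m < k, s (i+m) = t (j+m) := by
  simp [window]

theorem isFactor_window {A : Type*} (s : ℕ → A) (i k : ℕ) : IsFactor s (window s i k) :=
  ⟨i, by rw [window_len]⟩

theorem IsFactor.of_snoc {A : Type*} {s : ℕ → A} {l : List A} {x : A}
    (h : IsFactor s (l ++ [x])) : ∃ i, l = window s i l.length ∧ x = s (i + l.length) := by
  obtain ⟨i, hi⟩ := h
  rw [List.length_append, List.length_singleton, window_succ_right] at hi
  have := List.append_inj' hi rfl
  exact ⟨i, this.1, by simpa using this.2⟩

theorem IsFactor.of_cons {A : Type*} {s : ℕ → A} {l : List A} {x : A}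
    (h : IsFactor s (x :: l)) : ∃ i, l = window s (i+1) l.length ∧ x = s i := by
  obtain ⟨i, hi⟩ := h
  rw [List.length_cons, window_succ_left] at hi
  rw [List.cons.injEq] at hi
  exact ⟨i, hi.2, hi.1⟩

theorem IsFactor.init {A : Type*} {s : ℕ → A} {l : List A} {x : A}
    (h : IsFactor s (l ++ [x])) : IsFactor s l := by
  obtain ⟨i, hi, _⟩ := h.of_snoc
  exact ⟨i, hi⟩

theorem IsFactor.tl {A : Type*} {s : ℕ → A} {l : List A} {x : A}
    (h : IsFactor s (x :: l)) : IsFactor s l := by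
  obtain ⟨i, hi, _⟩ := h.of_cons
  exact ⟨i+1, hi⟩

theorem IsFactor.ext_right {A : Type*} {s : ℕ → A} {l : List A}
    (h : IsFactor s l) : ∃ x, IsFactor s (l ++ [x]) := by
  obtain ⟨i, hi⟩ := h
  refine ⟨s (i + l.length), i, ?_⟩
  rw [List.length_append, List.length_singleton, window_succ_right, ← hi]

/-- right special -/
def RSpec (s : ℕ → Fin 2) (w : List (Fin 2)) : Prop :=
  IsFactor s (w ++ [0]) ∧ IsFactor s (w ++ [1])

def LSpec (s : ℕ → Fin 2) (w : List (Fin 2)) : Prop :=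
  IsFactor s (0 :: w) ∧ IsFactor s (1 :: w)

theorem fin2_cases (x : Fin 2) : x = 0 ∨ x = 1 := by omega

theorem two_vals {P : Fin 2 → Prop} {a b : Fin 2} (h : a ≠ b) (ha : P a) (hb : P b) :
    P 0 ∧ P 1 := by
  rcases fin2_cases a with rfl | rfl <;> rcases fin2_cases b with rfl | rfl <;> tauto

theorem leftSpecial_iff (s : ℕ → Fin 2) (w) : LeftSpecial s w ↔ LSpec s w := by
  constructor
  · rintro ⟨x, y, h, hx, hy⟩
    exact two_vals (P := fun x => IsFactor s (x :: w)) h hx hy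
  · rintro ⟨h0, h1⟩
    exact ⟨0, 1, by decide, h0, h1⟩

def Fac (s : ℕ → Fin 2) (k : ℕ) : Set (List (Fin 2)) := {l | l.length = k ∧ IsFactor s l}

theorem fac_finite (s : ℕ → Fin 2) (k : ℕ) : (Fac s k).Finite :=
  (List.finite_length_eq (Fin 2) k).subset fun _ h => h.1

theorem count_gen (e : Fin 2 → List (Fin 2) → List (Fin 2)) (G H : Set (List (Fin 2)))
    (hH : H.Finite) (hinj : ∀ x, Function.Injective (e x)) (hd : ∀ u v, e 0 u ≠ e 1 v)
    (hG : ∀ l ∈ G, ∃ x, ∃ w ∈ H, l = e x w) (hext : ∀ w ∈ H, ∃ x, e x w ∈ G) :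
    G.ncard = H.ncard + {w | w ∈ H ∧ e 0 w ∈ G ∧ e 1 w ∈ G}.ncard := by
  set A : Fin 2 → Set (List (Fin 2)) := fun x => {w | w ∈ H ∧ e x w ∈ G} with hA
  have hAf : ∀ x, (A x).Finite := fun x => hH.subset fun _ h => h.1
  have h1 : G = e 0 '' A 0 ∪ e 1 '' A 1 := by
    ext l
    constructor
    · intro hl
      obtain ⟨x, w, hw, rfl⟩ := hG l hl
      rcases fin2_cases x with rfl | rfl
      · exact Or.inl ⟨w, ⟨hw, hl⟩, rfl⟩
      · exact Or.inr ⟨w, ⟨hw, hl⟩, rfl⟩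
    · rintro (⟨w, hw, rfl⟩ | ⟨w, hw, rfl⟩) <;> exact hw.2
  have h2 : H = A 0 ∪ A 1 := by
    ext w
    constructor
    · intro hw
      obtain ⟨x, hx⟩ := hext w hw
      rcases fin2_cases x with rfl | rfl
      · exact Or.inl ⟨hw, hx⟩
      · exact Or.inr ⟨hw, hx⟩
    · rintro (h | h) <;> exact h.1
  have h3 : {w | w ∈ H ∧ e 0 w ∈ G ∧ e 1 w ∈ G} = A 0 ∩ A 1 := by
    ext w; simp only [hA, Set.mem_setOf_eq, Set.mem_inter_iff]; tauto
  have h4 : G.ncard = (A 0).ncard + (A 1).ncard := by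
    rw [h1, Set.ncard_union_eq _ ((hAf 0).image _) ((hAf 1).image _),
      Set.ncard_image_of_injective _ (hinj 0), Set.ncard_image_of_injective _ (hinj 1)]
    rw [Set.disjoint_left]
    rintro _ ⟨u, _, rfl⟩ ⟨v, _, h⟩
    exact hd u v h.symm
  rw [h3, h4, ← Set.ncard_union_add_ncard_inter _ _ (hAf 0) (hAf 1), ← h2]

theorem count_right (s : ℕ → Fin 2) (k : ℕ) :
    (Fac s (k+1)).ncard = (Fac s k).ncard + {w | w.length = k ∧ RSpec s w}.ncard := by
  rw [count_gen (fun x w => w ++ [x]) (Fac s (k+1)) (Fac s k) (fac_finite s k)]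
  · congr 2
    ext w
    simp only [Fac, RSpec, Set.mem_setOf_eq, List.length_append, List.length_singleton]
    constructor
    · tauto
    · rintro ⟨rfl, h⟩
      exact ⟨⟨rfl, h.1.init⟩, ⟨rfl, h.1⟩, rfl, h.2⟩
  · intro x u v h; simpa using h
  · intro u v h; have := (List.append_inj' h rfl).2; simp at this
  · rintro l ⟨hl, i, hi⟩
    rw [hl, window_succ_right] at hi
    exact ⟨_, _, ⟨window_len _ _ _, isFactor_window _ _ _⟩, hi⟩
  · rintro w ⟨hl, hw⟩
    obtain ⟨x, hx⟩ := hw.ext_right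
    exact ⟨x, by simp [hl], hx⟩

theorem count_left (s : ℕ → Fin 2) (hs : ∀ l, IsFactor s l → ∃ x, IsFactor s (x :: l)) (k : ℕ) :
    (Fac s (k+1)).ncard = (Fac s k).ncard + {w | w.length = k ∧ LSpec s w}.ncard := by
  rw [count_gen (fun x w => x :: w) (Fac s (k+1)) (Fac s k) (fac_finite s k)]
  · congr 2
    ext w
    simp only [Fac, LSpec, Set.mem_setOf_eq, List.length_cons]
    constructor
    · tauto
    · rintro ⟨rfl, h⟩
      exact ⟨⟨rfl, h.1.tl⟩, ⟨rfl, h.1⟩, rfl, h.2⟩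
  · intro x u v h; simpa using h
  · intro u v h; simp at h
  · rintro l ⟨hl, i, hi⟩
    rw [hl, window_succ_left] at hi
    exact ⟨_, _, ⟨window_len _ _ _, isFactor_window _ _ _⟩, hi⟩
  · rintro w ⟨hl, hw⟩
    obtain ⟨x, hx⟩ := hs w hw
    exact ⟨x, by simp [hl], hx⟩

theorem fac_zero (s : ℕ → Fin 2) : (Fac s 0).ncard = 1 := by
  rw [Set.ncard_eq_one]
  refine ⟨[], ?_⟩
  ext l
  simp only [Fac, Set.mem_setOf_eq, List.length_eq_zero_iff, Set.mem_singleton_iff]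
  constructor
  · exact fun h => h.1
  · rintro rfl; exact ⟨rfl, 0, rfl⟩

theorem nonspec_next (s : ℕ → Fin 2) (k p q : ℕ) (h : window s p k = window s q k)
    (hn : ¬ RSpec s (window s p k)) : s (p+k) = s (q+k) := by
  by_contra hne
  apply hn
  refine two_vals (P := fun x => IsFactor s (window s p k ++ [x])) hne ?_ ?_
  · rw [← window_succ_right]; exact isFactor_window _ _ _
  · rw [h, ← window_succ_right]; exact isFactor_window _ _ _

theorem periodic_of (s : ℕ → Fin 2) (k i j : ℕ) (hij : i < j)
    (h : window s i k = window s j k)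
    (hn : ∀ m, i ≤ m → m < j → ¬ RSpec s (window s m k)) : UltimatelyPeriodic s := by
  have key : ∀ n, window s (i+n) k = window s (j+n) k ∧
      ∃ m, i ≤ m ∧ m < j ∧ window s (i+n) k = window s m k := by
    intro n
    induction n using Nat.strong_induction_on with
    | _ n ih =>
      rcases n with _ | n
      · exact ⟨h, i, le_rfl, hij, rfl⟩
      · constructor
        · obtain ⟨h1, m, hm1, hm2, hm3⟩ := ih n (by omega)
          have h2 := nonspec_next s k _ _ h1 (hm3 ▸ hn m hm1 hm2)
          have h3 : window s (i+n) (k+1) = window s (j+n) (k+1) := by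
            rw [window_succ_right, window_succ_right, h1, h2]
          rw [window_succ_left, window_succ_left, List.cons.injEq] at h3
          exact h3.2
        · by_cases hc : i + (n+1) < j
          · exact ⟨i + (n+1), by omega, hc, rfl⟩
          · obtain ⟨h1, m, hm1, hm2, hm3⟩ := ih (i+n+1-j) (by omega)
            refine ⟨m, hm1, hm2, ?_⟩
            rw [← hm3, h1]
            congr 1; omega
  refine ⟨i+k, j-i, by omega, ?_⟩
  intro n hnn
  obtain ⟨h1, m, hm1, hm2, hm3⟩ := key (n-i-k)
  have h2 := nonspec_next s k _ _ h1 (hm3 ▸ hn m hm1 hm2)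
  have e1 : i + (n-i-k) + k = n := by omega
  have e2 : j + (n-i-k) + k = n + (j-i) := by omega
  rw [e1, e2] at h2
  exact h2.symm

theorem exists_rspec (s : ℕ → Fin 2) (hap : ¬ UltimatelyPeriodic s) (k : ℕ) :
    ∃ w, w.length = k ∧ RSpec s w := by
  by_contra hno
  push Not at hno
  apply hap
  have hni : ¬ Set.InjOn (fun i => window s i k) Set.univ := by
    intro hinj
    have : Set.Infinite ((fun i => window s i k) '' Set.univ) :=
      Set.infinite_univ.image hinj
    refine this ((fac_finite s k).subset ?_)
    rintro _ ⟨i, _, rfl⟩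
    exact ⟨window_len _ _ _, isFactor_window _ _ _⟩
  simp only [Set.InjOn, Set.mem_univ, true_implies] at hni
  push Not at hni
  obtain ⟨i, j, he, hne⟩ := hni
  have hn : ∀ m, ¬ RSpec s (window s m k) := fun m => hno _ (window_len _ _ _)
  rcases Nat.lt_or_gt_of_ne hne with h | h
  · exact periodic_of s k i j h he fun m _ _ => hn m
  · exact periodic_of s k j i h he.symm fun m _ _ => hn m

theorem rspec_finite (s : ℕ → Fin 2) (k : ℕ) : {w | w.length = k ∧ RSpec s w}.Finite :=
  (List.finite_length_eq (Fin 2) k).subset fun _ h => h.1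

theorem lspec_finite (s : ℕ → Fin 2) (k : ℕ) : {w | w.length = k ∧ LSpec s w}.Finite :=
  (List.finite_length_eq (Fin 2) k).subset fun _ h => h.1

theorem le_fac (s : ℕ → Fin 2) (hap : ¬ UltimatelyPeriodic s) (k : ℕ) :
    k + 1 ≤ (Fac s k).ncard := by
  induction k with
  | zero => rw [fac_zero]
  | succ k ih =>
    rw [count_right]
    have : 0 < {w | w.length = k ∧ RSpec s w}.ncard :=
      (Set.ncard_pos (rspec_finite s k)).2 (exists_rspec s hap k)
    omega

theorem window_shift {A : Type*} (s : ℕ → A) (i k : ℕ) :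
    window (shiftMap s) i k = window s (i+1) k := by
  rw [window_eq_iff]
  intro m _
  simp only [shiftMap]
  congr 1; omega

theorem sturm_fac (s : ℕ → Fin 2) (h : Sturmian s) (k : ℕ) : (Fac s k).ncard = k + 1 := by
  rcases Nat.eq_zero_or_pos k with rfl | hk
  · exact fac_zero s
  · exact h k hk

theorem ext_left (s : ℕ → Fin 2) (hap : ¬ UltimatelyPeriodic s) (h : Sturmian s) :
    ∀ l, IsFactor s l → ∃ x, IsFactor s (x :: l) := by
  intro l hl
  have hap' : ¬ UltimatelyPeriodic (shiftMap s) := by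
    rintro ⟨N, q, hq, hN⟩
    apply hap
    refine ⟨N+1, q, hq, fun n hn => ?_⟩
    have := hN (n-1) (by omega)
    simp only [shiftMap] at this
    have e1 : n - 1 + q + 1 = n + q := by omega
    have e2 : n - 1 + 1 = n := by omega
    rwa [e1, e2] at this
  have hsub : Fac (shiftMap s) l.length ⊆ Fac s l.length := by
    rintro w ⟨hw, i, hi⟩
    exact ⟨hw, i+1, by rw [hi, window_shift, window_len]⟩
  have heq := Set.eq_of_subset_of_ncard_le hsub
    (by rw [sturm_fac s h]; exact le_fac _ hap' _) (fac_finite s _)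
  have hm : l ∈ Fac (shiftMap s) l.length := heq ▸ ⟨rfl, hl⟩
  obtain ⟨_, i, hi⟩ := hm
  refine ⟨s i, i, ?_⟩
  rw [List.length_cons, window_succ_left, ← window_shift, ← hi]

theorem rspec_unique (s : ℕ → Fin 2) (h : Sturmian s) {u v : List (Fin 2)}
    (hl : u.length = v.length) (hu : RSpec s u) (hv : RSpec s v) : u = v := by
  have := count_right s v.length
  rw [sturm_fac s h, sturm_fac s h] at this
  have h1 : {w | w.length = v.length ∧ RSpec s w}.ncard ≤ 1 := by omega
  exact (Set.ncard_le_one (rspec_finite s _)).1 h1 u ⟨hl, hu⟩ v ⟨rfl, hv⟩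

theorem lspec_one (s : ℕ → Fin 2) (hap : ¬ UltimatelyPeriodic s) (h : Sturmian s) (k : ℕ) :
    {w | w.length = k ∧ LSpec s w}.ncard = 1 := by
  have := count_left s (ext_left s hap h) k
  rw [sturm_fac s h, sturm_fac s h] at this
  omega

theorem lspec_unique (s : ℕ → Fin 2) (hap : ¬ UltimatelyPeriodic s) (h : Sturmian s)
    {u v : List (Fin 2)}
    (hl : u.length = v.length) (hu : LSpec s u) (hv : LSpec s v) : u = v :=
  (Set.ncard_le_one (lspec_finite s _)).1 (lspec_one s hap h v.length).le u ⟨hl, hu⟩ v ⟨rfl, hv⟩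

theorem pal_aux (s : ℕ → Fin 2) (hap : ¬ UltimatelyPeriodic s) (h : Sturmian s)
    (w : List (Fin 2)) (hw : w.reverse = w) (b c : Fin 2) (hbc : c ≠ b)
    (hb : IsFactor s (b :: (w ++ [b]))) (hr : RSpec s (c :: w)) : False := by
  set n := w.length with hn
  obtain ⟨i, h1, h2⟩ := hb.of_cons
  rw [List.length_append, List.length_singleton, window_succ_right] at h1
  have h3 := List.append_inj' h1 rfl
  obtain ⟨h3, h4⟩ := h3
  rw [← hn] at h3 h4
  have h4 : b = s (i+1+n) := by simpa using h4
  -- w as function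
  have hwf : ∀ m, (hm : m < w.length) → w[m] = s (i+1+m) := by
    intro m hm
    rw [List.getElem_of_eq h3 hm]
    simp [window]
  have hpal : ∀ m, m < n → s (i+1+m) = s (i+1+(n-1-m)) := by
    intro m hm
    rw [← hwf m hm, ← hwf (n-1-m) (by omega)]
    rw [List.getElem_of_eq hw.symm hm, List.getElem_reverse]
  have hne : ∀ t, t ≤ n+1 → window s (i+t) (n+1) ≠ c :: w := by
    intro t ht he
    rw [window_succ_left, List.cons.injEq, h3, window_eq_iff] at he
    obtain ⟨he1, he2⟩ := he
    rcases Nat.eq_zero_or_pos t with rfl | htp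
    · exact hbc (by rw [h2, ← he1]; rfl)
    · rcases Nat.eq_or_lt_of_le ht with rfl | htn
      · apply hbc; rw [h4, ← he1]; congr 1; omega
      · have e1 := he2 (n-t) (by omega)
        have e2 := hpal (t-1) (by omega)
        apply hbc
        rw [h4, ← he1]
        have a1 : i + t + 1 + (n-t) = i+1+n := by omega
        have a2 : i + 1 + (t-1) = i + t := by omega
        have a3 : n - 1 - (t-1) = n - t := by omega
        rw [a1] at e1
        rw [a2, a3] at e2
        rw [e1, e2]
  have hns : ∀ t, t ≤ n+1 → ¬ RSpec s (window s (i+t) (n+1)) := by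
    intro t ht hsp
    exact hne t ht (rspec_unique s h (by rw [window_len]; simp [hn]) hsp hr)
  -- pigeonhole
  have hfin : (Fac s (n+1) \ {c :: w}).Finite := (fac_finite s _).subset Set.diff_subset
  have hcard : (Fac s (n+1) \ {c :: w}).ncard = n + 1 := by
    rw [Set.ncard_diff_singleton_of_mem, sturm_fac s h]
    · rfl
    · exact ⟨by simp [hn], hr.1.init⟩
  have hc2 : hfin.toFinset.card < (Finset.range (n+2)).card := by
    rw [← Set.ncard_eq_toFinset_card _ hfin, hcard, Finset.card_range]; omega
  obtain ⟨x, hx, y, hy, hxy, he⟩ := Finset.exists_ne_map_eq_of_card_lt_of_maps_to hc2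
    (f := fun t => window s (i+t) (n+1)) (by
      intro t ht
      have ht := Finset.mem_range.1 ht
      rw [Set.Finite.coe_toFinset]
      exact ⟨⟨window_len _ _ _, isFactor_window _ _ _⟩, hne t (by omega)⟩)
  rw [Finset.mem_range] at hx hy
  have fin : ∀ x y, x < y → y < n+2 → window s (i+x) (n+1) = window s (i+y) (n+1) → False := by
    intro x y hlt hy he
    apply hap
    refine periodic_of s (n+1) (i+x) (i+y) (by omega) he ?_
    intro m hm1 hm2
    have := hns (m-i) (by omega)
    have e : i + (m-i) = m := by omega
    rwa [e] at this
  rcases Nat.lt_or_gt_of_ne hxy with hlt | hlt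
  · exact fin x y hlt hy he
  · exact fin y x hlt hx he.symm

theorem pal_main (s : ℕ → Fin 2) (hap : ¬ UltimatelyPeriodic s) (h : Sturmian s)
    (w : List (Fin 2)) (hw : w.reverse = w)
    (h0 : IsFactor s (0 :: (w ++ [0]))) (h1 : IsFactor s (1 :: (w ++ [1]))) : False := by
  obtain ⟨r, hr1, hr2⟩ := exists_rspec s hap (w.length+1)
  obtain ⟨c, v, rfl⟩ := List.exists_cons_of_length_eq_add_one hr1
  have hv : RSpec s v := ⟨IsFactor.tl hr2.1, IsFactor.tl hr2.2⟩
  have hvw : v = w := rspec_unique s h (by simpa using hr1) hv ⟨h0.tl, h1.tl⟩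
  subst hvw
  rcases fin2_cases c with rfl | rfl
  · exact pal_aux s hap h v hw 1 0 (by decide) h1 hr2
  · exact pal_aux s hap h v hw 0 1 (by decide) h0 hr2

theorem ne_flip {x y : Fin 2} (h : x ≠ y) : x = 1 - y := by
  revert x y; decide

theorem rev_closed (s : ℕ → Fin 2) (hap : ¬ UltimatelyPeriodic s) (h : Sturmian s) (n : ℕ) :
    ∀ l : List (Fin 2), l.length = n → IsFactor s l → IsFactor s l.reverse := by
  induction n using Nat.strong_induction_on with
  | _ n ih =>
    intro l hl hf
    rcases l with _ | ⟨a, l⟩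
    · simpa using hf
    rcases List.eq_nil_or_concat' l with rfl | ⟨w, b, rfl⟩
    · simpa using hf
    by_contra hno
    simp only [List.length_cons, List.length_append, List.length_nil] at hl
    have hno' : ¬ IsFactor s (b :: (w.reverse ++ [a])) := by simpa using hno
    have hwb := hf.tl
    have haw : IsFactor s (a :: w) := by
      have : IsFactor s ((a :: w) ++ [b]) := hf
      exact this.init
    have f1 : IsFactor s (b :: w.reverse) := by
      simpa using ih (n-1) (by omega) _ (by simp; omega) hwb
    have f2 : IsFactor s (w.reverse ++ [a]) := by
      simpa using ih (n-1) (by omega) _ (by simp; omega) haw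
    obtain ⟨x, hx⟩ := ext_left s hap h _ f2
    obtain ⟨y, hy⟩ := f1.ext_right
    have hy : IsFactor s (b :: (w.reverse ++ [y])) := hy
    have hxb : x ≠ b := by rintro rfl; exact hno' hx
    have hya : y ≠ a := by rintro rfl; exact hno' hy
    have hxw : IsFactor s (x :: w.reverse) := by
      have : IsFactor s ((x :: w.reverse) ++ [a]) := hx
      exact this.init
    have hLr : LSpec s w.reverse :=
      two_vals (P := fun x => IsFactor s (x :: w.reverse)) hxb hxw f1
    have hyw : IsFactor s (y :: w) := by
      simpa using ih (n-1) (by omega) _ (by simp; omega) hy.tl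
    have hL : LSpec s w := two_vals (P := fun x => IsFactor s (x :: w)) hya hyw haw
    have hw : w.reverse = w := lspec_unique s hap h (by simp) hLr hL
    rw [hw] at hno' hx hy
    by_cases hab : a = b
    · subst hab; exact hno' hf
    · have hxa : x = a := by rw [ne_flip hxb, ne_flip hab]
      have hyb : y = b := by rw [ne_flip hya, ne_flip (Ne.symm hab)]
      subst hxa hyb
      have := two_vals (P := fun x => IsFactor s (x :: (w ++ [x]))) hab hx hy
      exact pal_main s hap h w hw this.1 this.2

theorem stmt5 (s : ℕ → Fin 2) (hap : ¬ UltimatelyPeriodic s) :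
    Sturmian s ↔
      ((∀ l : List (Fin 2), IsFactor s l → IsFactor s l.reverse) ∧
       ∀ k ≥ 1, ∃! w : List (Fin 2), w.length = k ∧ LeftSpecial s w) := by
  simp only [leftSpecial_iff]
  constructor
  · intro h
    refine ⟨fun l hl => rev_closed s hap h _ l rfl hl, fun k _ => ?_⟩
    obtain ⟨w, hw⟩ := Set.ncard_eq_one.1 (lspec_one s hap h k)
    have hm : ∀ v, v.length = k ∧ LSpec s v ↔ v = w := fun v => by
      have := Set.ext_iff.1 hw v
      simpa using this
    exact ⟨w, (hm w).2 rfl, fun v hv => (hm v).1 hv⟩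
  · rintro ⟨hrev, huniq⟩
    have hext : ∀ l, IsFactor s l → ∃ x, IsFactor s (x :: l) := by
      intro l hl
      obtain ⟨x, hx⟩ := (hrev l hl).ext_right
      exact ⟨x, by simpa using hrev _ hx⟩
    have hfac : ∀ k, (Fac s k).ncard = k + 1 := by
      intro k
      induction k with
      | zero => exact fac_zero s
      | succ k ih =>
        rw [count_left s hext, ih]
        congr 1
        rw [Set.ncard_eq_one]
        rcases Nat.eq_zero_or_pos k with rfl | hk
        · obtain ⟨w, hw, hw2⟩ := exists_rspec s hap 0
          rw [List.length_eq_zero_iff] at hw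
          subst hw
          refine ⟨[], ?_⟩
          ext v
          simp only [Set.mem_setOf_eq, List.length_eq_zero_iff, Set.mem_singleton_iff]
          constructor
          · exact fun h => h.1
          · rintro rfl; exact ⟨rfl, hw2⟩
        · obtain ⟨w, hw, hu⟩ := huniq k hk
          refine ⟨w, ?_⟩
          ext v
          simp only [Set.mem_setOf_eq, Set.mem_singleton_iff]
          constructor
          · exact fun h => hu v h
          · rintro rfl; exact hw
    exact fun k _ => hfac k
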